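/- Let D be a division ring with center F, let d₁, …, dₙ ∈ D with d₁, …, d_{n−1} algebraic over F with minimal polynomials f₁(x), …, f_{n−1}(x) ∈ F[x], and suppose the conjugacy classes [d₁], …, [dₙ] are pairwise distinct. For i = 1, …, n−1 let Sᵢ(x) ∈ D[x] be such that fᵢ(x) = Sᵢ(x)·(x − dᵢ), and for 2 ≤ k ≤ n set Pₖ(x) := S₁(x)⋯S_{k−1}(x). Then dₖ is not a root of f_{k−1}(x)⋯f₁(x), and dₖ is not a root of Pₖ(x); in particular Pₖ(dₖ) ≠ 0. -/

import Mathlib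

open Polynomial

/-- The conjugacy class of `a` in a division ring. -/
def conjClass {D : Type*} [DivisionRing D] (a : D) : Set D :=
  {b | ∃ d : D, d ≠ 0 ∧ b = d * a * d⁻¹}

theorem Polynomial.eval_mul_eq_zero_of_eval_right {R : Type*} [Ring R] {a : R} {p : R[X]}
    (hp : p.eval a = 0) (q : R[X]) : (q * p).eval a = 0 := by
  induction q using Polynomial.induction_on' with
  | add q r hq hr => rw [add_mul, eval_add, hq, hr, add_zero]
  | monomial n c =>
    rw [← C_mul_X_pow_eq_monomial, mul_assoc, eval_C_mul, (commute_X_pow p n).eq,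
      eval_mul_X_pow, hp, zero_mul, mul_zero]

theorem commute_map_center {D : Type*} [DivisionRing D] (p : (Subring.center D)[X]) (q : D[X]) :
    Commute (p.map (algebraMap (Subring.center D) D)) q := by
  induction p using Polynomial.induction_on' with
  | add p r hp hr => rw [Polynomial.map_add]; exact hp.add_left hr
  | monomial n c =>
    rw [map_monomial, ← C_mul_X_pow_eq_monomial]
    refine Commute.mul_left ?_ (commute_X_pow q n)
    ext i
    rw [coeff_C_mul, coeff_mul_C]
    exact (Subring.mem_center_iff.mp c.2 _).symm

/-- A nonzero polynomial all of whose right multiples by constants vanish at `b` dominates the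
degree of a monic polynomial over the center vanishing at `b`. -/
theorem exists_monic_center_aeval_eq_zero {D : Type*} [DivisionRing D] {b : D} (P : D[X])
    (hP : P ≠ 0) (hb : ∀ c : D, (P * C c).eval b = 0) :
    ∃ p : (Subring.center D)[X], p.Monic ∧ aeval b p = 0 ∧ p.natDegree ≤ P.natDegree := by
  induction hn : P.natDegree using Nat.strong_induction_on generalizing P with
  | _ n ih =>
  subst hn
  have hlc : P.leadingCoeff⁻¹ ≠ 0 := inv_ne_zero (leadingCoeff_ne_zero.mpr hP)
  obtain ⟨Q, hQ⟩ : ∃ Q, Q = C P.leadingCoeff⁻¹ * P := ⟨_, rfl⟩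
  have hQm : Q.Monic := by
    rw [Monic, hQ, leadingCoeff_mul, leadingCoeff_C,
      inv_mul_cancel₀ (leadingCoeff_ne_zero.mpr hP)]
  have hQd : Q.natDegree = P.natDegree := by
    rw [hQ, natDegree_C_mul hlc]
  have hQb : ∀ c : D, (Q * C c).eval b = 0 := fun c => by
    rw [hQ, mul_assoc, eval_C_mul, hb, mul_zero]
  by_cases hcomm : ∀ c : D, Q * C c = C c * Q
  · have hmem : ∀ i, Q.coeff i ∈ Subring.center D := fun i => by
      rw [Subring.mem_center_iff]
      intro c
      rw [← coeff_C_mul, ← hcomm, coeff_mul_C]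
    have hlift : Q ∈ lifts (algebraMap (Subring.center D) D) := by
      rw [lifts_iff_coeff_lifts]
      exact fun i => ⟨⟨_, hmem i⟩, rfl⟩
    obtain ⟨p, hpQ, hpd, hpm⟩ := lifts_and_natDegree_eq_and_monic hlift hQm
    refine ⟨p, hpm, ?_, (hpd.trans hQd).le⟩
    rw [← eval_map_algebraMap, hpQ]
    simpa using hQb 1
  · push Not at hcomm
    obtain ⟨c, hc⟩ := hcomm
    have hc0 : c ≠ 0 := by
      rintro rfl
      simp at hc
    have hne : Q * C c - C c * Q ≠ 0 := sub_ne_zero.mpr hc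
    have hlt : (Q * C c - C c * Q).natDegree < P.natDegree := by
      rw [← hQd, ← natDegree_mul_C hc0 (p := Q)]
      refine natDegree_lt_natDegree hne (degree_sub_lt_left ?_ ?_ ?_)
      · rw [degree_mul, degree_mul, degree_C hc0, add_zero, zero_add]
      · exact mul_ne_zero hQm.ne_zero (C_ne_zero.mpr hc0)
      · rw [leadingCoeff_mul, leadingCoeff_mul, hQm.leadingCoeff, one_mul, mul_one]
    obtain ⟨p, hp, hpb, hpd⟩ := ih _ hlt _ hne (fun e => by
      rw [sub_mul, eval_sub, mul_assoc, ← C_mul, hQb, mul_assoc, eval_C_mul, hQb, mul_zero,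
        sub_zero]) rfl
    exact ⟨p, hp, hpb, hpd.trans hlt.le⟩

theorem minpoly_eq_X_sub_C_mul {D : Type*} [DivisionRing D] {a : D} {S : D[X]}
    (hS : (minpoly (Subring.center D) a).map (algebraMap (Subring.center D) D)
      = S * (X - C a)) :
    (minpoly (Subring.center D) a).map (algebraMap (Subring.center D) D) = (X - C a) * S := by
  refine mul_right_cancel₀ (X_sub_C_ne_zero a) ?_
  rw [mul_assoc, ← hS]
  exact (commute_map_center _ _).eq

/-- **Dickson's theorem**: roots of the minimal polynomial of `a` over the center are conjugate
to `a`. -/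
theorem exists_conj_of_aeval_minpoly_eq_zero {D : Type*} [DivisionRing D] {a b : D} {S : D[X]}
    (ha : IsIntegral (Subring.center D) a)
    (hS : (minpoly (Subring.center D) a).map (algebraMap (Subring.center D) D)
      = S * (X - C a))
    (hb : aeval b (minpoly (Subring.center D) a) = 0) :
    ∃ u : D, u ≠ 0 ∧ a = u * b * u⁻¹ := by
  have hmonic := minpoly.monic ha
  have hS0 : S ≠ 0 := by
    rintro rfl
    rw [zero_mul] at hS
    exact (hmonic.map _).ne_zero hS
  by_cases h : ∀ c : D, (S * C c).eval b = 0
  · exfalso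
    obtain ⟨p, hp, hpb, hpd⟩ := exists_monic_center_aeval_eq_zero S hS0 h
    have hdeg := congrArg natDegree hS
    rw [hmonic.natDegree_map, natDegree_mul hS0 (X_sub_C_ne_zero a), natDegree_X_sub_C] at hdeg
    have hmin := minpoly.eq_of_irreducible_of_monic (minpoly.irreducible ha) hb hmonic
    have hle := natDegree_le_of_dvd (minpoly.dvd (Subring.center D) b hpb) hp.ne_zero
    rw [← hmin] at hle
    omega
  · push Not at h
    obtain ⟨c, hc⟩ := h
    refine ⟨_, hc, ?_⟩
    have hzero : ((X - C a) * (S * C c)).eval b = 0 := by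
      rw [← mul_assoc, ← minpoly_eq_X_sub_C_mul hS, (commute_map_center _ (C c)).eq,
        eval_C_mul, eval_map_algebraMap, hb, mul_zero]
    rw [sub_mul, eval_sub, X_mul, eval_mul_X, eval_C_mul, sub_eq_zero] at hzero
    rw [hzero, mul_inv_cancel_right₀ hc]

theorem conjClass_eq_of_conj {D : Type*} [DivisionRing D] {a b u : D} (hu : u ≠ 0)
    (h : a = u * b * u⁻¹) : conjClass a = conjClass b := by
  subst h
  ext x
  constructor
  · rintro ⟨v, hv, rfl⟩
    exact ⟨v * u, mul_ne_zero hv hu, by simp only [mul_inv_rev, mul_assoc]⟩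
  · rintro ⟨v, hv, rfl⟩
    exact ⟨v * u⁻¹, mul_ne_zero hv (inv_ne_zero hu), by simp [mul_assoc, hu]⟩

theorem exists_mul_prod_eq_prod_reverse {M : Type*} [Monoid M] (m : ℕ) (f S g : Fin m → M)
    (hf : ∀ i q, Commute (f i) q) (hfS : ∀ i, f i = g i * S i) :
    ∃ q, (List.ofFn f).reverse.prod = q * (List.ofFn S).prod := by
  induction m with
  | zero => exact ⟨1, by simp⟩
  | succ m ih =>
    obtain ⟨q, hq⟩ := ih (fun i => f i.castSucc) (fun i => S i.castSucc)
      (fun i => g i.castSucc) (fun i => hf _) (fun i => hfS _)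
    have hcentral (r : M) :
        Commute (List.ofFn fun i : Fin m => f i.castSucc).reverse.prod r :=
      Commute.list_prod_left _ _ fun x hx => by
        obtain ⟨i, rfl⟩ := List.mem_ofFn.mp (List.mem_reverse.mp hx)
        exact hf _ _
    refine ⟨g (Fin.last m) * q, ?_⟩
    rw [List.ofFn_succ', List.ofFn_succ', List.concat_eq_append, List.concat_eq_append,
      List.reverse_append, List.prod_append, List.prod_append, hq, List.reverse_singleton,
      List.prod_singleton, List.prod_singleton, hfS, mul_assoc, mul_assoc, ← mul_assoc q,
      ← hq, (hcentral _).eq]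

/-- **Lemma (`dₖ` is not a root of `fₖ₋₁⋯f₁` nor of `Pₖ = S₁⋯Sₖ₋₁`).**
Let `D` be a division ring with center `F`, `d₁, …, dₙ ∈ D` with `d₁, …, dₙ₋₁` algebraic
over `F` with minimal polynomials `fᵢ`, pairwise distinct conjugacy classes `[dᵢ]`, and
`Sᵢ(x) ∈ D[x]` with `fᵢ(x) = Sᵢ(x)·(x − dᵢ)`.  Then for `2 ≤ k ≤ n`, `dₖ` is not a root
of `fₖ₋₁(x)⋯f₁(x)`, and `dₖ` is not a root of `Pₖ(x) = S₁(x)⋯Sₖ₋₁(x)`. -/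
theorem dk_not_root {D : Type*} [DivisionRing D]
    (n : ℕ) (d : Fin n → D)
    (halg : ∀ i : Fin n, (i : ℕ) < n - 1 → IsIntegral (Subring.center D) (d i))
    (hdist : ∀ i j : Fin n, i ≠ j → conjClass (d i) ≠ conjClass (d j))
    (S : Fin n → Polynomial D)
    (hS : ∀ i : Fin n, (i : ℕ) < n - 1 →
      (minpoly (Subring.center D) (d i)).map (algebraMap (Subring.center D) D)
        = S i * (X - C (d i)))
    (k : Fin n) (hk : 1 ≤ (k : ℕ)) :
    (((List.ofFn fun i : Fin k =>
        (minpoly (Subring.center D) (d ⟨i, i.isLt.trans k.isLt⟩)).map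
          (algebraMap (Subring.center D) D)).reverse).prod).eval (d k) ≠ 0 ∧
    ((List.ofFn fun i : Fin k => S ⟨i, i.isLt.trans k.isLt⟩).prod).eval (d k) ≠ 0 := by
  have hlt (i : Fin k) : (i : ℕ) < n - 1 := by
    have := i.isLt
    have := k.isLt
    omega
  have hroot : (((List.ofFn fun i : Fin k =>
        (minpoly (Subring.center D) (d ⟨i, i.isLt.trans k.isLt⟩)).map
          (algebraMap (Subring.center D) D)).reverse).prod).eval (d k) ≠ 0 := by
    have hmap : (List.ofFn fun i : Fin k =>
        (minpoly (Subring.center D) (d ⟨i, i.isLt.trans k.isLt⟩)).map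
          (algebraMap (Subring.center D) D)).reverse.prod =
        ((List.ofFn fun i : Fin k =>
          minpoly (Subring.center D) (d ⟨i, i.isLt.trans k.isLt⟩)).reverse.prod).map
            (algebraMap (Subring.center D) D) := by
      rw [← coe_mapRingHom, map_list_prod, List.map_reverse, List.map_ofFn]
      rfl
    rw [hmap, eval_map_algebraMap, map_list_prod]
    refine List.prod_ne_zero fun hmem => ?_
    simp only [List.mem_map, List.mem_reverse, List.mem_ofFn, exists_exists_eq_and] at hmem
    obtain ⟨i, hi⟩ := hmem
    obtain ⟨u, hu, hconj⟩ :=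
      exists_conj_of_aeval_minpoly_eq_zero (halg _ (hlt i)) (hS _ (hlt i)) hi
    refine hdist _ _ (fun h => ?_) (conjClass_eq_of_conj hu hconj)
    exact i.isLt.ne (congrArg Fin.val h)
  refine ⟨hroot, fun h => hroot ?_⟩
  obtain ⟨q, hq⟩ := exists_mul_prod_eq_prod_reverse k
    (fun i : Fin k => (minpoly (Subring.center D) (d ⟨i, i.isLt.trans k.isLt⟩)).map
      (algebraMap (Subring.center D) D))
    (fun i => S ⟨i, i.isLt.trans k.isLt⟩) (fun i => X - C (d ⟨i, i.isLt.trans k.isLt⟩))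
    (fun i p => commute_map_center _ p)
    (fun i => minpoly_eq_X_sub_C_mul (hS _ (hlt i)))
  rw [hq]
  exact eval_mul_eq_zero_of_eval_right h q
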